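/- arXiv:2206.02974 — 2 statements merged into one kernel-verified Lean document; each statement's English description precedes it below -/
import Mathlib

section
/- Let X : ℝ^n × ℝ → ℝ^n be a C^∞ time-dependent vector field whose solutions define a complete evolution φ(t, t₀, x) (so ∂_t φ(t, t₀, x) = X(φ(t, t₀, x), t) and φ(t₀, t₀, x) = x), with all derivatives in x up to order r bounded, and let r ≥ 1. Suppose ω ∈ ℝ^n is nonwandering for this evolution: for every ε > 0 and every T > 0 there exist x with ‖x − ω‖ < ε and t > T with ‖φ(t, 0, x) − ω‖ < ε. Then for every α > 0 and every ε > 0 there exist a C^∞ time-dependent vector field Y : ℝ^n × ℝ → ℝ^n with sup_{x, t} ‖iteratedFDeriv ℝ q (X(·, t)) x − iteratedFDeriv ℝ q (Y(·, t)) x‖ ≤ α for every q = 0, 1, …, r, a point p with ‖p − ω‖ < ε, and a time T > 0 such that the solution ψ of x' = Y(x, t) with ψ(0) = p satisfies ψ(T) = p; moreover Y(x, t) = X(x, t) whenever x lies outside the ε-neighborhood of the closed curve {ψ(t) : t ∈ [0, T]}. -/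
open Set Filter Metric

noncomputable section

/-- Euclidean space ℝ^n. -/
abbrev Euc (n : ℕ) := EuclideanSpace ℝ (Fin n)

/-- `φ t t₀ x` is the globally defined evolution of the time-dependent vector field `X`. -/
def IsEvolution {n : ℕ} (X : Euc n × ℝ → Euc n) (φ : ℝ → ℝ → Euc n → Euc n) : Prop :=
  (∀ t₀ x, φ t₀ t₀ x = x) ∧
    (∀ t₀ x t, HasDerivAt (fun τ => φ τ t₀ x) (X (φ t t₀ x, t)) t)

/-- Trajectories of a smooth time-dependent vector field are smooth. -/
lemma contDiff_of_hasDerivAt_timeDependent {E : Type*} [NormedAddCommGroup E] [NormedSpace ℝ E]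
    {X : E × ℝ → E} (hX : ContDiff ℝ (⊤ : ℕ∞) X) {c : ℝ → E}
    (hc : ∀ t, HasDerivAt c (X (c t, t)) t) : ContDiff ℝ (⊤ : ℕ∞) c := by
  rw [contDiff_infty]
  intro k
  induction k with
  | zero =>
    exact contDiff_zero.2 (continuous_iff_continuousAt.2 fun t => (hc t).continuousAt)
  | succ k ih =>
    have hd : deriv c = fun t => X (c t, t) := funext fun t => (hc t).deriv
    push_cast
    refine contDiff_succ_iff_deriv.2 ⟨fun t => (hc t).differentiableAt, by simp, ?_⟩
    rw [hd]
    exact (hX.of_le (by exact_mod_cast le_top)).comp (ih.prodMk contDiff_id)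

/-- Two trajectories that are close at time `b` were close at every earlier time, with constants
controlled by the Lipschitz constant of the vector field. -/
lemma dist_le_of_trajectories_backward {E : Type*} [NormedAddCommGroup E] [NormedSpace ℝ E]
    {X : E × ℝ → E} {K : NNReal} (hK : ∀ t, LipschitzWith K fun y => X (y, t)) {c d : ℝ → E}
    (hc : ∀ t, HasDerivAt c (X (c t, t)) t) (hd : ∀ t, HasDerivAt d (X (d t, t)) t) {s b : ℝ}
    (hs : s ≤ b) : dist (c s) (d s) ≤ dist (c b) (d b) * Real.exp (K * (b - s)) := by
  have key : ∀ {e : ℝ → E}, (∀ t, HasDerivAt e (X (e t, t)) t) →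
      ∀ t, HasDerivAt (fun τ => e (b - τ)) (-X (e (b - t), b - t)) t := by
    intro e he t
    exact (he (b - t)).comp_const_sub b t
  have h := dist_le_of_trajectories_ODE (v := fun t y => -X (y, b - t)) (K := K)
    (f := fun τ => c (b - τ)) (g := fun τ => d (b - τ)) (a := 0) (b := b - s)
    (δ := dist (c b) (d b)) (fun t => (hK (b - t)).neg)
    (fun t _ => (key hc t).continuousAt.continuousWithinAt)
    (fun t _ => (key hc t).hasDerivWithinAt)
    (fun t _ => (key hd t).continuousAt.continuousWithinAt)
    (fun t _ => (key hd t).hasDerivWithinAt) (by simp) (b - s) ⟨by linarith, le_rfl⟩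
  simpa using h

lemma deriv_smoothTransition_eq_zero {x : ℝ} (hx : x < 0 ∨ 1 < x) :
    deriv Real.smoothTransition x = 0 := by
  rcases hx with hx | hx
  · have h : Real.smoothTransition =ᶠ[nhds x] fun _ => 0 :=
      Filter.mem_of_superset (Iio_mem_nhds hx) fun y hy =>
        Real.smoothTransition.zero_of_nonpos (le_of_lt hy)
    simp [h.deriv_eq]
  · have h : Real.smoothTransition =ᶠ[nhds x] fun _ => 1 :=
      Filter.mem_of_superset (Ioi_mem_nhds hx) fun y hy =>
        Real.smoothTransition.one_of_one_le (le_of_lt hy)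
    simp [h.deriv_eq]

/-- Derivatives of a compactly supported smooth function are bounded uniformly up to any order. -/
lemma exists_bound_iteratedFDeriv {E : Type*} [NormedAddCommGroup E] [NormedSpace ℝ E]
    {f : E → ℝ} (hf : ContDiff ℝ (⊤ : ℕ∞) f) (hs : HasCompactSupport f) (r : ℕ) :
    ∃ M > 0, ∀ q ≤ r, ∀ x, ‖iteratedFDeriv ℝ q f x‖ ≤ M := by
  have h : ∀ q : ℕ, ∃ C, ∀ x, ‖iteratedFDeriv ℝ q f x‖ ≤ C := fun q =>
    (hf.continuous_iteratedFDeriv (by exact_mod_cast le_top)).bounded_above_of_compact_support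
      (hs.iteratedFDeriv q)
  choose C hC using h
  refine ⟨1 + ∑ q ∈ Finset.range (r + 1), |C q|, by positivity, fun q hq x => ?_⟩
  have h1 : |C q| ≤ ∑ q ∈ Finset.range (r + 1), |C q| :=
    Finset.single_le_sum (f := fun q => |C q|) (fun _ _ => abs_nonneg _)
      (Finset.mem_range.2 (Nat.lt_succ_of_le hq))
  linarith [hC q x, le_abs_self (C q)]

lemma norm_iteratedFDeriv_bump_smul_le {E : Type*} [NormedAddCommGroup E] [NormedSpace ℝ E]
    {f : E → ℝ} (hf : ContDiff ℝ (⊤ : ℕ∞) f) (a w : E) (q : ℕ) {M : ℝ}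
    (hM : ∀ x, ‖iteratedFDeriv ℝ q f x‖ ≤ M) (x : E) :
    ‖iteratedFDeriv ℝ q (fun y => f (y - a) • w) x‖ ≤ ‖w‖ * M := by
  have hg : ContDiff ℝ (⊤ : ℕ∞) fun y => f (y - a) := hf.comp (contDiff_id.sub contDiff_const)
  have h := (ContinuousLinearMap.toSpanSingleton ℝ w).norm_iteratedFDeriv_comp_left
    (x := x) (n := q) hg.contDiffAt (by exact_mod_cast le_top)
  rw [ContinuousLinearMap.norm_toSpanSingleton, iteratedFDeriv_comp_sub] at h
  exact h.trans (by gcongr; exact hM _)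

/-- The interpolation between two nearby trajectories of a Lipschitz vector field is almost a
trajectory. -/
lemma norm_interpolation_defect_le {E : Type*} [NormedAddCommGroup E] [NormedSpace ℝ E]
    {F : E → E} {K : NNReal} (hF : LipschitzWith K F) {η η' C : ℝ} (h0 : 0 ≤ η) (h1 : η ≤ 1)
    (hC : |η'| ≤ C) (a b : E) :
    ‖η' • (b - a) + (F a + η • (F b - F a)) - F (a + η • (b - a))‖ ≤ (C + 2 * K) * ‖b - a‖ := by
  have e : η' • (b - a) + (F a + η • (F b - F a)) - F (a + η • (b - a)) =
      η' • (b - a) + (η • (F b - F a) - (F (a + η • (b - a)) - F a)) := by abel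
  have b1 : ‖η' • (b - a)‖ ≤ C * ‖b - a‖ := by
    rw [norm_smul, Real.norm_eq_abs]; gcongr
  have b2 : ‖η • (F b - F a)‖ ≤ K * ‖b - a‖ := by
    rw [norm_smul, Real.norm_of_nonneg h0]
    have := hF.norm_sub_le b a
    nlinarith [norm_nonneg (F b - F a)]
  have b3 : ‖F (a + η • (b - a)) - F a‖ ≤ K * ‖b - a‖ := by
    refine (hF.norm_sub_le _ _).trans ?_
    rw [add_sub_cancel_left, norm_smul, Real.norm_of_nonneg h0]
    gcongr
    nlinarith [norm_nonneg (b - a)]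
  rw [e]
  linarith [norm_add_le (η' • (b - a)) (η • (F b - F a) - (F (a + η • (b - a)) - F a)),
    norm_sub_le (η • (F b - F a)) (F (a + η • (b - a)) - F a)]

/-- the nonautonomous C^r closing lemma. -/
theorem stmt2 {n : ℕ} (hn : 1 ≤ n) (r : ℕ) (hr : 1 ≤ r)
    (X : Euc n × ℝ → Euc n) (hX : ContDiff ℝ (⊤ : ℕ∞) X)
    (φ : ℝ → ℝ → Euc n → Euc n) (hφ : IsEvolution X φ)
    (hbdd : ∀ q ≤ r, ∃ K : ℝ, ∀ (x : Euc n) (t : ℝ),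
      ‖iteratedFDeriv ℝ q (fun y => X (y, t)) x‖ ≤ K)
    (ω : Euc n)
    (hω : ∀ ε > (0:ℝ), ∀ T > (0:ℝ), ∃ x : Euc n, ‖x - ω‖ < ε ∧ ∃ t > T, ‖φ t 0 x - ω‖ < ε) :
    ∀ α > (0:ℝ), ∀ ε > (0:ℝ),
      ∃ Y : Euc n × ℝ → Euc n, ContDiff ℝ (⊤ : ℕ∞) Y ∧
        (∀ q ≤ r, ∀ (x : Euc n) (t : ℝ),
          ‖iteratedFDeriv ℝ q (fun y => X (y, t)) x -
            iteratedFDeriv ℝ q (fun y => Y (y, t)) x‖ ≤ α) ∧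
        ∃ p : Euc n, ‖p - ω‖ < ε ∧
          ∃ T > (0:ℝ), ∃ ψ : ℝ → Euc n,
            ψ 0 = p ∧ (∀ t, HasDerivAt ψ (Y (ψ t, t)) t) ∧ ψ T = p ∧
              ∀ (x : Euc n) (t : ℝ),
                (∀ s ∈ Set.Icc (0:ℝ) T, ε ≤ ‖x - ψ s‖) → Y (x, t) = X (x, t) := by
  intro α hα ε hε
  obtain ⟨K₀, hK₀⟩ := hbdd 1 hr
  have hXs : ∀ t, ContDiff ℝ (⊤ : ℕ∞) fun y => X (y, t) := fun t =>
    hX.comp (contDiff_id.prodMk contDiff_const)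
  obtain ⟨K, hK⟩ : ∃ K : NNReal, ∀ t, LipschitzWith K fun y => X (y, t) := by
    refine ⟨K₀.toNNReal, fun t => lipschitzWith_of_nnnorm_fderiv_le
      ((hXs t).differentiable (by simp)) fun x => ?_⟩
    rw [← NNReal.coe_le_coe, coe_nnnorm, ← norm_iteratedFDeriv_one]
    exact (hK₀ x t).trans (Real.le_coe_toNNReal _)
  obtain ⟨C, hC⟩ := isCompact_Icc.exists_bound_of_continuousOn (s := Set.Icc (0:ℝ) 1)
    ((Real.smoothTransition.contDiff (n := ⊤)).continuous_deriv (by simp)).continuousOn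
  have hC0 : 0 ≤ C := (norm_nonneg _).trans (hC 0 (by simp))
  obtain ⟨β, hβ, hβc, hβ1, hβ0⟩ : ∃ β : Euc n → ℝ, ContDiff ℝ (⊤ : ℕ∞) β ∧
      HasCompactSupport β ∧ β 0 = 1 ∧ ∀ x, ε ≤ ‖x‖ → β x = 0 := by
    let β : ContDiffBump (0 : Euc n) := ⟨ε / 2, ε, by positivity, by linarith⟩
    exact ⟨β, β.contDiff, β.hasCompactSupport,
      β.one_of_mem_closedBall (by simp [β.rIn_pos.le]),
      fun x hx => β.zero_of_le_dist (by simpa using hx)⟩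
  obtain ⟨M, hM0, hM⟩ := exists_bound_iteratedFDeriv hβ hβc r
  set A := (C + 2 * K) * Real.exp K * M + 1 with hA
  have hA0 : 0 < A := by positivity
  obtain ⟨p, hp, T, hT, hpT⟩ := hω (min ε (α / (2 * A))) (by positivity) 1 one_pos
  have hclose : dist (φ T 0 p) p ≤ α / A := by
    rw [dist_eq_norm, ← sub_sub_sub_cancel_right _ _ ω]
    have e : α / A = α / (2 * A) + α / (2 * A) := by field_simp; norm_num
    rw [e]
    exact (norm_sub_le _ _).trans (add_le_add (hpT.le.trans (min_le_right _ _))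
      (hp.le.trans (min_le_right _ _)))
  set c : ℝ → Euc n := fun s => φ s 0 p with hc_def
  set d : ℝ → Euc n := fun s => φ s T p with hd_def
  have hc : ∀ t, HasDerivAt c (X (c t, t)) t := hφ.2 0 p
  have hd : ∀ t, HasDerivAt d (X (d t, t)) t := hφ.2 T p
  have hcs := contDiff_of_hasDerivAt_timeDependent hX hc
  have hds := contDiff_of_hasDerivAt_timeDependent hX hd
  set η : ℝ → ℝ := fun s => Real.smoothTransition (s - (T - 1)) with hη_def
  set η' : ℝ → ℝ := fun s => deriv Real.smoothTransition (s - (T - 1)) with hη'_def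
  have hsm : ContDiff ℝ (⊤ : ℕ∞) Real.smoothTransition := Real.smoothTransition.contDiff
  have hη : ∀ s, HasDerivAt η (η' s) s := fun s =>
    ((hsm.differentiable (by simp)) _).hasDerivAt.comp_sub_const s (T - 1)
  have hshift : ContDiff ℝ (⊤ : ℕ∞) fun s : ℝ => s - (T - 1) := contDiff_id.sub contDiff_const
  have hηs : ContDiff ℝ (⊤ : ℕ∞) η := hsm.comp hshift
  have hη's : ContDiff ℝ (⊤ : ℕ∞) η' := (contDiff_infty_iff_deriv.1 hsm).2.comp hshift
  set ψ : ℝ → Euc n := fun s => c s + η s • (d s - c s) with hψ_def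
  have hψs : ContDiff ℝ (⊤ : ℕ∞) ψ := hcs.add (hηs.smul (hds.sub hcs))
  set g : ℝ → Euc n := fun s =>
    η' s • (d s - c s) + (X (c s, s) + η s • (X (d s, s) - X (c s, s))) - X (ψ s, s) with hg_def
  have hXc : ∀ {e : ℝ → Euc n}, ContDiff ℝ (⊤ : ℕ∞) e →
      ContDiff ℝ (⊤ : ℕ∞) fun s => X (e s, s) := fun he => hX.comp (he.prodMk contDiff_id)
  have hgs : ContDiff ℝ (⊤ : ℕ∞) g :=
    ((hη's.smul (hds.sub hcs)).add ((hXc hcs).add (hηs.smul ((hXc hds).sub (hXc hcs))))).sub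
      (hXc hψs)
  have hg_out : ∀ s, s ∉ Set.Icc (T - 1) T → g s = 0 := by
    intro s hs
    rcases lt_or_ge s (T - 1) with h | h
    · have h1 : η s = 0 := Real.smoothTransition.zero_of_nonpos (by linarith)
      have h2 : η' s = 0 := deriv_smoothTransition_eq_zero (Or.inl (by linarith))
      simp [hg_def, hψ_def, h1, h2]
    · have h' : T < s := lt_of_not_ge fun h' => hs ⟨h, h'⟩
      have h1 : η s = 1 := Real.smoothTransition.one_of_one_le (by linarith)
      have h2 : η' s = 0 := deriv_smoothTransition_eq_zero (Or.inr (by linarith))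
      simp [hg_def, hψ_def, h1, h2]
  have hg_le : ∀ s, ‖g s‖ * M ≤ α := by
    intro s
    by_cases hs : s ∈ Set.Icc (T - 1) T
    · have h1 := norm_interpolation_defect_le (hK s) (η := η s) (η' := η' s)
        (Real.smoothTransition.nonneg _) (Real.smoothTransition.le_one _)
        (hC (s - (T - 1)) ⟨by linarith [hs.1], by linarith [hs.2]⟩) (c s) (d s)
      have h2 := dist_le_of_trajectories_backward hK hc hd hs.2
      have h3 : Real.exp (K * (T - s)) ≤ Real.exp K :=
        Real.exp_le_exp.2 (mul_le_of_le_one_right K.2 (by linarith [hs.1]))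
      have h4 : dist (c T) (d T) ≤ α / A := by
        rw [show d T = p from hφ.1 T p]; exact hclose
      have h5 : ‖d s - c s‖ ≤ α / A * Real.exp K := by
        rw [← dist_eq_norm, dist_comm]
        exact h2.trans (by gcongr)
      calc ‖g s‖ * M ≤ ((C + 2 * K) * (α / A * Real.exp K)) * M := by
            gcongr
            exact h1.trans (by gcongr)
        _ = α / A * (A - 1) := by rw [hA]; ring
        _ ≤ α / A * A := by gcongr; linarith
        _ = α := by field_simp
    · simp [hg_out s hs, hα.le]
  have hW : ContDiff ℝ (⊤ : ℕ∞) fun z : Euc n × ℝ => β (z.1 - ψ z.2) • g z.2 :=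
    (hβ.comp (contDiff_fst.sub (hψs.comp contDiff_snd))).smul (hgs.comp contDiff_snd)
  refine ⟨fun z => X z + β (z.1 - ψ z.2) • g z.2, hX.add hW, ?_, p,
    hp.trans_le (min_le_left _ _), T, by linarith, ψ, ?_, ?_, ?_, ?_⟩
  · intro q hq x t
    have hWt : ContDiff ℝ (⊤ : ℕ∞) fun y => β (y - ψ t) • g t :=
      (hβ.comp (contDiff_id.sub contDiff_const)).smul contDiff_const
    have hq' : (q : WithTop ℕ∞) ≤ ((⊤ : ℕ∞) : WithTop ℕ∞) := by exact_mod_cast le_top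
    have e : iteratedFDeriv ℝ q (fun y => X (y, t) + β (y - ψ t) • g t) x =
        iteratedFDeriv ℝ q (fun y => X (y, t)) x +
          iteratedFDeriv ℝ q (fun y => β (y - ψ t) • g t) x :=
      fun_iteratedFDeriv_add_apply ((hXs t).of_le hq').contDiffAt (hWt.of_le hq').contDiffAt
    rw [e, sub_add_cancel_left, norm_neg]
    exact (norm_iteratedFDeriv_bump_smul_le hβ (ψ t) (g t) q (hM q hq) x).trans (hg_le t)
  · have h1 : η 0 = 0 := Real.smoothTransition.zero_of_nonpos (by linarith)
    simp [hψ_def, h1, hc_def, hφ.1 0 p]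
  · intro t
    have h1 : β (ψ t - ψ t) = 1 := by rw [sub_self, hβ1]
    refine ((hc t).add ((hη t).smul ((hd t).sub (hc t)))).congr_deriv ?_
    simp only [h1, one_smul, hg_def, Pi.sub_apply]
    abel
  · have h1 : η T = 1 := Real.smoothTransition.one_of_one_le (by linarith)
    simp [hψ_def, h1, hd_def, hφ.1 T p]
  · intro x t hx
    by_cases ht : t ∈ Set.Icc (T - 1) T
    · have h1 : β (x - ψ t) = 0 := hβ0 _ (hx t ⟨by linarith [ht.1], ht.2⟩)
      simp [h1]
    · simp [hg_out t ht]
end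
end

section
/- Let I ⊆ ℝ be an interval, let f : I → ℝ^n be a C² curve parametrized by arc length (‖f'(s)‖ = 1 for all s ∈ I) whose curvature is bounded by K > 0 (‖f''(s)‖ ≤ K for all s ∈ I), and let 0 < ε < 1/K. Let x ∈ ℝ^n and s₁, s₂ ∈ I be such that ‖x − f(s)‖ ≤ ε for every s between s₁ and s₂, and such that x − f(s₁) is orthogonal to f'(s₁) and x − f(s₂) is orthogonal to f'(s₂). Then s₁ = s₂; that is, within a tube of radius less than the reciprocal of the curvature bound, the orthogonal projection onto the curve is unique along any arc staying in the tube. -/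
open Set
open scoped RealInnerProductSpace

noncomputable section

/-- Along a unit-speed arc whose curvature is at most `K`, staying at distance at most `ε < 1 / K`
from `x`, the vector `x - f s` cannot be orthogonal to the curve at both endpoints. -/
theorem not_orthogonal_endpoints_of_curvature_le {E : Type*} [NormedAddCommGroup E]
    [InnerProductSpace ℝ E] {f f' f'' : ℝ → E} {K ε a b : ℝ} {x : E} (hab : a < b)
    (hK : 0 < K) (hεK : ε < 1 / K)
    (hderiv : ∀ s ∈ Icc a b, HasDerivWithinAt f (f' s) (Icc a b) s)
    (hderiv2 : ∀ s ∈ Icc a b, HasDerivWithinAt f' (f'' s) (Icc a b) s)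
    (hunit : ∀ s ∈ Icc a b, ‖f' s‖ = 1) (hcurv : ∀ s ∈ Icc a b, ‖f'' s‖ ≤ K)
    (htube : ∀ s ∈ Icc a b, ‖x - f s‖ ≤ ε)
    (ha : ⟪x - f a, f' a⟫ = 0) (hb : ⟪x - f b, f' b⟫ = 0) : False := by
  have hg : ∀ s ∈ Icc a b, HasDerivWithinAt (fun t => ⟪x - f t, f' t⟫)
      (⟪x - f s, f'' s⟫ + ⟪-f' s, f' s⟫) (Icc a b) s := fun s hs =>
    ((hderiv s hs).const_sub x).inner ℝ (hderiv2 s hs)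
  obtain ⟨c, hc, hc0⟩ := exists_hasDerivAt_eq_zero hab
    (fun s hs => (hg s hs).continuousWithinAt) (ha.trans hb.symm)
    (fun s hs => (hg s (Ioo_subset_Icc_self hs)).hasDerivAt (Icc_mem_nhds hs.1 hs.2))
  have hcI := Ioo_subset_Icc_self hc
  rw [inner_neg_left, real_inner_self_eq_norm_sq, hunit c hcI] at hc0
  have hlt : ε * K < 1 := (lt_div_iff₀ hK).mp hεK
  have hle : ⟪x - f c, f'' c⟫ ≤ ε * K := (real_inner_le_norm _ _).trans
    (mul_le_mul (htube c hcI) (hcurv c hcI) (norm_nonneg _)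
      ((norm_nonneg _).trans (htube c hcI)))
  linarith

/-- uniqueness of the orthogonal projection onto a unit-speed curve of
curvature at most K inside a tube of radius ε < 1/K (the 'long flow box'). -/
theorem stmt12 {n : ℕ} (hn : 1 ≤ n) (I : Set ℝ) (hI : I.OrdConnected)
    (f f' f'' : ℝ → Euc n) (K ε : ℝ) (hK : 0 < K)
    (hderiv : ∀ s ∈ I, HasDerivWithinAt f (f' s) I s)
    (hderiv2 : ∀ s ∈ I, HasDerivWithinAt f' (f'' s) I s)
    (hunit : ∀ s ∈ I, ‖f' s‖ = 1)
    (hcurv : ∀ s ∈ I, ‖f'' s‖ ≤ K)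
    (hε : 0 < ε) (hεK : ε < 1 / K)
    (x : Euc n) (s₁ s₂ : ℝ) (hs₁ : s₁ ∈ I) (hs₂ : s₂ ∈ I)
    (htube : ∀ s ∈ Set.uIcc s₁ s₂, ‖x - f s‖ ≤ ε)
    (horth₁ : ⟪x - f s₁, f' s₁⟫ = 0)
    (horth₂ : ⟪x - f s₂, f' s₂⟫ = 0) :
    s₁ = s₂ := by
  by_contra hne
  have hsub : uIcc s₁ s₂ ⊆ I := hI.uIcc_subset hs₁ hs₂
  have hd := fun s hs => (hderiv s (hsub hs)).mono hsub
  have hd2 := fun s hs => (hderiv2 s (hsub hs)).mono hsub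
  have hu := fun s hs => hunit s (hsub hs)
  have hc := fun s hs => hcurv s (hsub hs)
  rcases lt_or_gt_of_ne hne with h | h
  · rw [uIcc_of_le h.le] at *
    exact not_orthogonal_endpoints_of_curvature_le h hK hεK hd hd2 hu hc htube horth₁ horth₂
  · rw [uIcc_of_ge h.le] at *
    exact not_orthogonal_endpoints_of_curvature_le h hK hεK hd hd2 hu hc htube horth₂ horth₁
end
end
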